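/- arXiv:2102.01320 — 2 statements merged into one kernel-verified Lean document; each statement's English description precedes it below -/
import Mathlib

section
/- The class of rankable binary functions is minor-closed: for a rankable binary function f on ground set E and any element e ∈ E, both the contraction f/e and the deletion f∖e are well defined and rankable. -/
/-- A binary function on finite ground set `E`: a function `f : 2^E → ℝ` with `f ∅ = 1`.
(The function is defined on all finite sets; only its values on subsets of `E` matter.) -/
structure BinaryFunction (α : Type) [DecidableEq α] where
  E : Finset α
  f : Finset α → ℝ
  empty_one : f ∅ = 1

namespace BinaryFunction

variable {α : Type} [DecidableEq α]

/-- Contraction of a single element: `(f/e)(Y) = f(Y)` on ground set `E ∖ {e}`. -/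
def contract (g : BinaryFunction α) (e : α) : BinaryFunction α :=
  ⟨g.E.erase e, g.f, g.empty_one⟩

/-- Deletion of a single element: `(f∖e)(Y) = (f(Y) + f(Y ∪ {e})) / (1 + f({e}))`
on ground set `E ∖ {e}`; well defined iff `1 + f({e}) ≠ 0` (in which case the
`if` branch below agrees with the formula, since the formula gives `1` at `∅`). -/
noncomputable def delete (g : BinaryFunction α) (e : α) : BinaryFunction α :=
  ⟨g.E.erase e,
   fun Y => if Y = ∅ then 1 else (g.f Y + g.f (Y ∪ {e})) / (1 + g.f {e}),
   by simp⟩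

/-- Contraction of a set: `(f/X)(Y) = f(Y)` on ground set `E ∖ X`. -/
def contractSet (g : BinaryFunction α) (X : Finset α) : BinaryFunction α :=
  ⟨g.E \ X, g.f, g.empty_one⟩

/-- Deletion of a set: `(f∖X)(Y) = (∑_{Z ⊆ X} f(Y ∪ Z)) / (∑_{Z ⊆ X} f(Z))`
on ground set `E ∖ X`; well defined iff `∑_{Z ⊆ X} f(Z) ≠ 0` (in which case the
`if` branch agrees with the formula, since the formula gives `1` at `∅`). -/
noncomputable def deleteSet (g : BinaryFunction α) (X : Finset α) : BinaryFunction α :=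
  ⟨g.E \ X,
   fun Y => if Y = ∅ then 1 else
     (∑ Z ∈ X.powerset, g.f (Y ∪ Z)) / (∑ Z ∈ X.powerset, g.f Z),
   by simp⟩

/-- `IsMinorOf m f`: `m` is obtained from `f` by a sequence of single-element
contractions and deletions, each step being well defined. -/
inductive IsMinorOf : BinaryFunction α → BinaryFunction α → Prop
  | refl (f : BinaryFunction α) : IsMinorOf f f
  | contract {f g : BinaryFunction α} (e : α) (he : e ∈ g.E)
      (h : IsMinorOf g f) : IsMinorOf (g.contract e) f
  | delete {f g : BinaryFunction α} (e : α) (he : e ∈ g.E)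
      (hw : 1 + g.f {e} ≠ 0) (h : IsMinorOf g f) : IsMinorOf (g.delete e) f

/-- `f` is stable: every sequence of single-element contractions and deletions applied
to `f` is well defined at every step, i.e. at every reachable minor `g`, deletion of any
ground-set element is well defined. -/
def Stable (f : BinaryFunction α) : Prop :=
  ∀ g : BinaryFunction α, IsMinorOf g f → ∀ e ∈ g.E, 1 + g.f {e} ≠ 0

/-- Isomorphism of binary functions: a bijection `φ` of ground sets with
`f(X) = f'(φ(X))` for all `X ⊆ E`. -/
def Isomorphic (g g' : BinaryFunction α) : Prop :=
  ∃ φ : α → α, Set.InjOn φ ↑g.E ∧ g.E.image φ = g'.E ∧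
    ∀ X ⊆ g.E, g.f X = g'.f (X.image φ)

/-- `f_α`: the order-one binary function on ground set `{e}` with value `α` on `{e}`. -/
def fAlpha (e : α) (a : ℝ) : BinaryFunction α :=
  ⟨{e}, fun X => if X = ∅ then 1 else a, by simp⟩

/-- The rank function `Qf(X) = log₂((∑_{Y ⊆ E} f(Y)) / (∑_{Y ⊆ E∖X} f(Y)))`. -/
noncomputable def Q (g : BinaryFunction α) (X : Finset α) : ℝ :=
  Real.logb 2 ((∑ Y ∈ g.E.powerset, g.f Y) / (∑ Y ∈ (g.E \ X).powerset, g.f Y))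

/-- `f` is rankable: for every `X ⊆ E` the denominator in `Qf(X)` is nonzero and
the quotient is strictly positive. -/
def Rankable (g : BinaryFunction α) : Prop :=
  ∀ X ⊆ g.E, (∑ Y ∈ (g.E \ X).powerset, g.f Y) ≠ 0 ∧
    0 < (∑ Y ∈ g.E.powerset, g.f Y) / (∑ Y ∈ (g.E \ X).powerset, g.f Y)

/-- `f` is `k`-polymatroidal: rankable, with `Qf` satisfying R0–R3. -/
def Polymatroidal (k : ℕ) (g : BinaryFunction α) : Prop :=
  Rankable g ∧
  (∀ X ⊆ g.E, ∃ n : ℕ, g.Q X = n) ∧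
  (∀ X ⊆ g.E, g.Q X ≤ (k : ℝ) * X.card) ∧
  (∀ X ⊆ g.E, ∀ e ∈ g.E, e ∉ X → g.Q X ≤ g.Q (insert e X)) ∧
  (∀ X ⊆ g.E, ∀ a ∈ g.E, ∀ b ∈ g.E, a ∉ X → b ∉ X → a ≠ b →
    g.Q X + g.Q (insert a (insert b X)) ≤ g.Q (insert a X) + g.Q (insert b X))

/-- `f` is linear: `{0,1}`-valued on subsets of `E`, and closed under symmetric
difference of supports. -/
def Linear (g : BinaryFunction α) : Prop :=
  (∀ X ⊆ g.E, g.f X = 0 ∨ g.f X = 1) ∧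
  (∀ X ⊆ g.E, ∀ Y ⊆ g.E, g.f X = 1 → g.f Y = 1 → g.f (symmDiff X Y) = 1)

/-- The order-two excluded minor `g`: value `1` on sets of size `0,1`, `-1` on size `2`. -/
def gTwo (a b : α) : BinaryFunction α :=
  ⟨{a, b}, fun X => if X.card = 2 then -1 else 1, by simp⟩

/-- The order-four excluded minor `f_{U_{2,4}}`: `1` on sizes `0,3`, `0` on sizes `1,2`,
`-1` on size `4`. -/
def fU24 (a b c d : α) : BinaryFunction α :=
  ⟨{a, b, c, d},
   fun X => if X.card = 0 then 1 else if X.card ≤ 2 then 0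
            else if X.card = 3 then 1 else -1,
   by simp⟩

/-- The order-two excluded minors `f_{α,β,γ}` of the `k`-polymatroidal binary functions. -/
def fABG (a b : α) (p q r : ℕ) : BinaryFunction α :=
  ⟨{a, b},
   fun X =>
     if X = ∅ then 1
     else if X = {a} then 2 ^ (p + r - q + 1) - 1
     else if X = {b} then 2 ^ (r + 1) - 1
     else 2 ^ (p + r + 1) - 2 ^ (r + 1) - 2 ^ (p + r - q + 1) + 1,
   by simp⟩

end BinaryFunction

namespace BinaryFunction

variable {α : Type} [DecidableEq α]

/-- Taking `X = E` in the definition shows that the total sum is positive, so rankability means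
that all partial sums over powersets of subsets of `E` are positive. -/
theorem rankable_iff_sum_powerset_pos (g : BinaryFunction α) :
    g.Rankable ↔ ∀ S ⊆ g.E, 0 < ∑ Y ∈ S.powerset, g.f Y := by
  constructor
  · intro h S hS
    have htotal : 0 < ∑ Y ∈ g.E.powerset, g.f Y := by
      simpa [g.empty_one] using (h g.E subset_rfl).2
    have hquot := (h (g.E \ S) Finset.sdiff_subset).2
    rw [Finset.sdiff_sdiff_eq_self hS] at hquot
    exact (div_pos_iff_of_pos_left htotal).1 hquot
  · intro h X _
    have hden := h (g.E \ X) Finset.sdiff_subset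
    exact ⟨hden.ne', div_pos (h g.E subset_rfl) hden⟩

theorem sum_powerset_delete (g : BinaryFunction α) {e : α} (hw : 1 + g.f {e} ≠ 0)
    {S : Finset α} (hS : e ∉ S) :
    ∑ Y ∈ S.powerset, (g.delete e).f Y =
      (∑ Y ∈ (insert e S).powerset, g.f Y) / (1 + g.f {e}) := by
  rw [Finset.sum_powerset_insert hS, ← Finset.sum_add_distrib, Finset.sum_div]
  refine Finset.sum_congr rfl fun Y _ => ?_
  rcases eq_or_ne Y ∅ with rfl | hY
  · simp [delete, g.empty_one, div_self hw]
  · simp [delete, hY]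

theorem Rankable.one_add_pos {g : BinaryFunction α} (hg : g.Rankable) {e : α} (he : e ∈ g.E) :
    0 < 1 + g.f {e} := by
  have h := g.rankable_iff_sum_powerset_pos.1 hg {e} (by simpa using he)
  rw [← insert_empty_eq, Finset.sum_powerset_insert (Finset.notMem_empty e)] at h
  simpa [g.empty_one] using h

theorem Rankable.contract {g : BinaryFunction α} (hg : g.Rankable) (e : α) :
    (g.contract e).Rankable := by
  rw [rankable_iff_sum_powerset_pos] at hg ⊢
  exact fun S hS => hg S (hS.trans (Finset.erase_subset e g.E))

theorem Rankable.delete {g : BinaryFunction α} (hg : g.Rankable) {e : α} (he : e ∈ g.E) :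
    (g.delete e).Rankable := by
  have hpos := hg.one_add_pos he
  rw [rankable_iff_sum_powerset_pos] at hg ⊢
  intro S hS
  obtain ⟨hSE, heS⟩ := Finset.subset_erase.1 hS
  rw [g.sum_powerset_delete hpos.ne' heS]
  exact div_pos (hg _ (Finset.insert_subset he hSE)) hpos

end BinaryFunction

open BinaryFunction in
/-- For a rankable binary function `f` and `e ∈ E`, both the contraction `f/e`
and the deletion `f∖e` are well defined and rankable. -/
theorem rankable_minor_closed {α : Type} [DecidableEq α] (f : BinaryFunction α) (e : α)
    (he : e ∈ f.E) (hf : f.Rankable) :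
    (f.contract e).Rankable ∧ 1 + f.f {e} ≠ 0 ∧ (f.delete e).Rankable :=
  ⟨hf.contract e, (hf.one_add_pos he).ne', hf.delete he⟩
end

section
/- Fix k ∈ ℕ, k ≥ 1. A binary function is k-polymatroidal if and only if it has no minor isomorphic to any of the following: (i) f_α for any α ∈ ℝ not of the form 2^n − 1 with n ∈ {0,1,…,k}; (ii) for any integers 0 ≤ α ≤ β ≤ γ ≤ k−1, the order-two binary function f_{α,β,γ} on ground set {a,b} with f_{α,β,γ}(∅)=1, f_{α,β,γ}({a}) = 2^{α+γ−β+1} − 1, f_{α,β,γ}({b}) = 2^{γ+1} − 1, and f_{α,β,γ}({a,b}) = 2^{α+γ+1} − 2^{γ+1} − 2^{α+γ−β+1} + 1. -/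
namespace BinaryFunction

variable {α : Type} [DecidableEq α]

/-- The sum of a binary function over all subsets of `X`. -/
def subsetSum (g : BinaryFunction α) (X : Finset α) : ℝ := ∑ Y ∈ X.powerset, g.f Y

theorem subsetSum_empty (g : BinaryFunction α) : g.subsetSum ∅ = 1 := by
  simp [subsetSum, g.empty_one]

theorem subsetSum_singleton (g : BinaryFunction α) (e : α) :
    g.subsetSum {e} = 1 + g.f {e} := by
  have h := Finset.sum_powerset_insert (s := ∅) (Finset.notMem_empty e) g.f
  simpa [subsetSum, g.empty_one] using h

theorem subsetSum_pair (g : BinaryFunction α) {a b : α} (hab : a ≠ b) :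
    g.subsetSum {a, b} = 1 + g.f {a} + g.f {b} + g.f {a, b} := by
  have ha : a ∉ ({b} : Finset α) := by simpa using hab
  have hb := g.subsetSum_singleton b
  have h := Finset.sum_powerset_insert (s := ∅) (Finset.notMem_empty b) fun Y => g.f (insert a Y)
  simp only [subsetSum] at hb ⊢
  rw [Finset.sum_powerset_insert ha, hb]
  simp only [insert_empty_eq, Finset.powerset_empty, Finset.sum_singleton] at h
  rw [h]
  ring

theorem contract_E (g : BinaryFunction α) (e : α) : (g.contract e).E = g.E.erase e := rfl

theorem delete_E (g : BinaryFunction α) (e : α) : (g.delete e).E = g.E.erase e := rfl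

theorem subsetSum_delete (g : BinaryFunction α) {e : α} (hw : 1 + g.f {e} ≠ 0)
    {X : Finset α} (he : e ∉ X) :
    (g.delete e).subsetSum X = g.subsetSum (insert e X) / g.subsetSum {e} := by
  have hf : ∀ Y, (g.delete e).f Y = (g.f Y + g.f (insert e Y)) / (1 + g.f {e}) := by
    intro Y
    by_cases hY : Y = ∅
    · subst hY
      simp [delete, g.empty_one, hw]
    · simp [delete, hY, Finset.union_singleton]
  rw [subsetSum_singleton]
  simp only [subsetSum]
  rw [Finset.sum_powerset_insert he, ← Finset.sum_add_distrib, Finset.sum_div]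
  exact Finset.sum_congr rfl fun Y _ => hf Y

/-- Every minor is a restriction of the quotient by its set of deleted elements. -/
theorem IsMinorOf.exists_deleted {m f : BinaryFunction α} (h : IsMinorOf m f) :
    m.E ⊆ f.E ∧ ∃ A ⊆ f.E, Disjoint m.E A ∧ f.subsetSum A ≠ 0 ∧
      ∀ X ⊆ m.E, m.subsetSum X = f.subsetSum (X ∪ A) / f.subsetSum A := by
  induction h with
  | refl f => exact ⟨subset_rfl, ∅, by simp [subsetSum_empty]⟩
  | contract e he _ ih =>
    obtain ⟨hE, A, hA, hd, h0, hS⟩ := ih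
    refine ⟨(Finset.erase_subset _ _).trans hE, A, hA,
      hd.mono_left (Finset.erase_subset _ _), h0, fun X hX => ?_⟩
    exact hS X (hX.trans (Finset.erase_subset _ _))
  | @delete f g e he hw _ ih =>
    obtain ⟨hE, A, hA, hd, h0, hS⟩ := ih
    have he' : ({e} : Finset α) ⊆ g.E := by simpa using he
    have h1 := hS {e} he'
    have h2 : g.subsetSum {e} ≠ 0 := by rwa [subsetSum_singleton]
    have h3 : f.subsetSum ({e} ∪ A) ≠ 0 := by
      intro h
      rw [h, zero_div] at h1
      exact h2 h1
    refine ⟨(Finset.erase_subset _ _).trans hE, {e} ∪ A,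
      Finset.union_subset (he'.trans hE) hA, ?_, h3, fun X hX => ?_⟩
    · rw [Finset.disjoint_union_right]
      exact ⟨by simp [delete_E], hd.mono_left (Finset.erase_subset _ _)⟩
    · have heX : e ∉ X := fun h => by simpa [delete_E] using hX h
      have hXE : X ⊆ g.E := hX.trans (Finset.erase_subset _ _)
      rw [subsetSum_delete g hw heX, hS _ (Finset.insert_subset he hXE), h1,
        div_div_div_cancel_right₀ h0]
      congr 2
      grind

/-- Contracting down to any subset of the ground set gives a minor. -/
theorem IsMinorOf.exists_contract {m f : BinaryFunction α} (h : IsMinorOf m f)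
    {B : Finset α} (hB : B ⊆ m.E) : ∃ m', IsMinorOf m' f ∧ m'.E = B ∧ m'.f = m.f := by
  have key : ∀ C ⊆ m.E, ∃ m', IsMinorOf m' f ∧ m'.E = m.E \ C ∧ m'.f = m.f := by
    intro C
    induction C using Finset.induction_on with
    | empty => exact fun _ => ⟨m, h, by simp, rfl⟩
    | insert e C heC ih =>
      intro hC
      rw [Finset.insert_subset_iff] at hC
      obtain ⟨m', hm', hE, hf⟩ := ih hC.2
      refine ⟨m'.contract e, .contract e (by simp [hE, hC.1, heC]) hm', ?_, hf⟩
      rw [contract_E, hE]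
      grind
  obtain ⟨m', h1, h2, h3⟩ := key (m.E \ B) Finset.sdiff_subset
  exact ⟨m', h1, by rw [h2, Finset.sdiff_sdiff_eq_self hB], h3⟩

theorem insert_sdiff_insert_self {E X : Finset α} {e : α} (he : e ∈ E) (heX : e ∉ X) :
    insert e (E \ insert e X) = E \ X := by
  grind

/-- `L` is a base-two logarithm of the subset sums of `f`; it is supermodular and
increases by at most `k` when an element is added. -/
def IsLogSum (k : ℕ) (f : BinaryFunction α) (L : Finset α → ℕ) : Prop :=
  (∀ X ⊆ f.E, f.subsetSum X = 2 ^ L X) ∧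
  (∀ X ⊆ f.E, ∀ e ∈ f.E, e ∉ X → L X ≤ L (insert e X) ∧ L (insert e X) ≤ L X + k) ∧
  (∀ X ⊆ f.E, ∀ a ∈ f.E, ∀ b ∈ f.E, a ∉ X → b ∉ X → a ≠ b →
    L (insert a X) + L (insert b X) ≤ L X + L (insert a (insert b X)))

theorem IsLogSum.polymatroidal {k : ℕ} {f : BinaryFunction α} {L : Finset α → ℕ}
    (h : f.IsLogSum k L) : f.Polymatroidal k := by
  obtain ⟨hS, hstep, hsup⟩ := h
  have hQ : ∀ X, f.Q X = (L f.E : ℝ) - L (f.E \ X) := by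
    intro X
    have h1 := hS f.E subset_rfl
    have h2 := hS (f.E \ X) Finset.sdiff_subset
    simp only [subsetSum] at h1 h2
    rw [Q, h1, h2, Real.logb_div (by positivity) (by positivity), Real.logb_pow, Real.logb_pow,
      Real.logb_self_eq_one (by norm_num), mul_one, mul_one]
  have hbound : ∀ X ⊆ f.E, L (f.E \ X) ≤ L f.E ∧ L f.E ≤ L (f.E \ X) + k * X.card := by
    intro X
    induction X using Finset.induction_on with
    | empty => simp
    | insert e X heX ih =>
      intro hX
      rw [Finset.insert_subset_iff] at hX
      have h1 := ih hX.2
      have h2 := hstep (f.E \ insert e X) Finset.sdiff_subset e hX.1 (by simp)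
      have h3 : insert e (f.E \ insert e X) = f.E \ X := insert_sdiff_insert_self hX.1 heX
      rw [h3] at h2
      rw [Finset.card_insert_of_notMem heX, mul_add, mul_one]
      lia
  refine ⟨fun X _ => ?_, fun X hX => ?_, fun X hX => ?_, fun X hX e he heX => ?_,
    fun X hX a ha b hb haX hbX hab => ?_⟩
  · have h1 := hS f.E subset_rfl
    have h2 := hS (f.E \ X) Finset.sdiff_subset
    simp only [subsetSum] at h1 h2
    rw [h1, h2]
    constructor <;> positivity
  · refine ⟨L f.E - L (f.E \ X), ?_⟩
    rw [hQ, Nat.cast_sub (hbound X hX).1]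
  · have h : (L f.E : ℝ) ≤ L (f.E \ X) + k * X.card := by exact_mod_cast (hbound X hX).2
    rw [hQ]
    linarith
  · have h2 := (hstep (f.E \ insert e X) Finset.sdiff_subset e he (by simp)).1
    have h3 : insert e (f.E \ insert e X) = f.E \ X := insert_sdiff_insert_self he heX
    rw [h3] at h2
    have h4 : (L (f.E \ insert e X) : ℝ) ≤ L (f.E \ X) := by exact_mod_cast h2
    rw [hQ, hQ]
    linarith
  · have h := hsup (f.E \ insert a (insert b X)) Finset.sdiff_subset a ha b hb
      (by simp) (by simp) hab
    have h1 : insert a (f.E \ insert a (insert b X)) = f.E \ insert b X :=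
      insert_sdiff_insert_self ha (by simp [hab, haX])
    have h2 : insert b (f.E \ insert a (insert b X)) = f.E \ insert a X := by
      rw [Finset.insert_comm a b]
      exact insert_sdiff_insert_self hb (by simp [hab.symm, hbX])
    have h3 : insert a (f.E \ insert a X) = f.E \ X := insert_sdiff_insert_self ha haX
    rw [h1, h2, h3] at h
    have h4 : (L (f.E \ insert b X) : ℝ) + L (f.E \ insert a X) ≤
      L (f.E \ insert a (insert b X)) + L (f.E \ X) := by exact_mod_cast h
    simp only [hQ]
    linarith

theorem Polymatroidal.exists_isLogSum {k : ℕ} {f : BinaryFunction α}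
    (h : f.Polymatroidal k) : ∃ L, f.IsLogSum k L := by
  obtain ⟨hR, hnat, hle, hmono, hsub⟩ := h
  have hN : ∀ X, ∃ n : ℕ, X ⊆ f.E → f.Q X = n := by
    intro X
    by_cases hX : X ⊆ f.E
    · obtain ⟨n, hn⟩ := hnat X hX
      exact ⟨n, fun _ => hn⟩
    · exact ⟨0, fun h => absurd h hX⟩
  choose N hN using hN
  have hmonoN : ∀ X ⊆ f.E, ∀ e ∈ f.E, e ∉ X → N X ≤ N (insert e X) := by
    intro X hX e he heX
    have h := hmono X hX e he heX
    rw [hN X hX, hN _ (Finset.insert_subset he hX)] at h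
    exact_mod_cast h
  have hsubN : ∀ X ⊆ f.E, ∀ a ∈ f.E, ∀ b ∈ f.E, a ∉ X → b ∉ X → a ≠ b →
      N X + N (insert a (insert b X)) ≤ N (insert a X) + N (insert b X) := by
    intro X hX a ha b hb haX hbX hab
    have h := hsub X hX a ha b hb haX hbX hab
    have hbX' := Finset.insert_subset hb hX
    rw [hN X hX, hN _ hbX', hN _ (Finset.insert_subset ha hX),
      hN _ (Finset.insert_subset ha hbX')] at h
    exact_mod_cast h
  have hstepN : ∀ e ∈ f.E, ∀ X ⊆ f.E, e ∉ X → N (insert e X) ≤ N X + k := by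
    intro e he X
    induction X using Finset.induction_on with
    | empty =>
      intro _ _
      have he' : ({e} : Finset α) ⊆ f.E := by simpa using he
      have h := hle {e} he'
      rw [hN _ he', Finset.card_singleton, Nat.cast_one, mul_one] at h
      have h' : N {e} ≤ k := by exact_mod_cast h
      rw [insert_empty_eq]
      lia
    | insert a X haX ih =>
      intro hX heX
      rw [Finset.insert_subset_iff] at hX
      simp only [Finset.mem_insert, not_or] at heX
      have h1 := ih hX.2 heX.2
      have h2 := hsubN X hX.2 e he a hX.1 heX.2 haX heX.1
      lia
  have hmonoE : ∀ X ⊆ f.E, N (f.E \ X) ≤ N f.E := by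
    intro X
    induction X using Finset.induction_on with
    | empty => simp
    | insert e X heX ih =>
      intro hX
      rw [Finset.insert_subset_iff] at hX
      have h1 := ih hX.2
      have h2 := hmonoN (f.E \ insert e X) Finset.sdiff_subset e hX.1 (by simp)
      have h3 : insert e (f.E \ insert e X) = f.E \ X := insert_sdiff_insert_self hX.1 heX
      rw [h3] at h2
      exact h2.trans h1
  have hpow : ∀ X ⊆ f.E, f.subsetSum f.E / f.subsetSum (f.E \ X) = 2 ^ N X := by
    intro X hX
    have h := hN X hX
    rw [Q, Real.logb_eq_iff_rpow_eq (by norm_num) (by norm_num) (hR X hX).2,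
      Real.rpow_natCast] at h
    exact h.symm
  have hE : f.subsetSum f.E = 2 ^ N f.E := by
    have h := hpow f.E subset_rfl
    rwa [Finset.sdiff_self, subsetSum_empty, div_one] at h
  refine ⟨fun X => N f.E - N (f.E \ X), fun X hX => ?_, fun X hX e he heX => ?_,
    fun X hX a ha b hb haX hbX hab => ?_⟩
  · have h := hpow (f.E \ X) Finset.sdiff_subset
    have h0 := (hR (f.E \ X) Finset.sdiff_subset).1
    rw [← subsetSum, Finset.sdiff_sdiff_eq_self hX] at h0
    rw [Finset.sdiff_sdiff_eq_self hX, hE, div_eq_iff h0] at h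
    rw [pow_sub₀ _ (by norm_num) (hmonoE X hX), h]
    field_simp
  · have h1 := hmonoE X hX
    have h2 := hmonoE _ (Finset.insert_subset he hX)
    have h3 : insert e (f.E \ insert e X) = f.E \ X := insert_sdiff_insert_self he heX
    have h4 := hmonoN (f.E \ insert e X) Finset.sdiff_subset e he (by simp)
    have h5 := hstepN e he (f.E \ insert e X) Finset.sdiff_subset (by simp)
    rw [h3] at h4 h5
    lia
  · have haX' := Finset.insert_subset ha hX
    have hbX' := Finset.insert_subset hb hX
    have h1 := hmonoE X hX
    have h2 := hmonoE _ haX'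
    have h3 := hmonoE _ hbX'
    have h4 := hmonoE _ (Finset.insert_subset ha hbX')
    have h5 := hsubN (f.E \ insert a (insert b X)) Finset.sdiff_subset a ha b hb
      (by simp) (by simp) hab
    have h6 : insert a (f.E \ insert a (insert b X)) = f.E \ insert b X :=
      insert_sdiff_insert_self ha (by simp [hab, haX])
    have h7 : insert b (f.E \ insert a (insert b X)) = f.E \ insert a X := by
      rw [Finset.insert_comm a b]
      exact insert_sdiff_insert_self hb (by simp [hab.symm, hbX])
    have h8 : insert a (f.E \ insert a X) = f.E \ X := insert_sdiff_insert_self ha haX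
    rw [h6, h7, h8] at h5
    lia

theorem polymatroidal_iff_exists_isLogSum {k : ℕ} {f : BinaryFunction α} :
    f.Polymatroidal k ↔ ∃ L, f.IsLogSum k L :=
  ⟨Polymatroidal.exists_isLogSum, fun ⟨_, h⟩ => h.polymatroidal⟩

theorem Isomorphic.subsetSum_eq {g g' : BinaryFunction α} {φ : α → α}
    (hinj : Set.InjOn φ g.E) (hf : ∀ X ⊆ g.E, g.f X = g'.f (X.image φ))
    {X : Finset α} (hX : X ⊆ g.E) : g.subsetSum X = g'.subsetSum (X.image φ) := by
  simp only [subsetSum, Finset.powerset_image]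
  rw [Finset.sum_image]
  · exact Finset.sum_congr rfl fun Y hY => hf Y ((Finset.mem_powerset.1 hY).trans hX)
  · intro Y hY Z hZ hYZ
    simp only [Finset.coe_powerset, Set.mem_preimage, Set.mem_powerset_iff,
      Finset.coe_subset] at hY hZ
    have h := congrArg (fun W : Finset α => (W : Set α)) hYZ
    simp only [Finset.coe_image] at h
    exact Finset.coe_injective ((hinj.image_eq_image_iff (by exact_mod_cast hY.trans hX)
      (by exact_mod_cast hZ.trans hX)).1 h)

theorem subsetSum_fAlpha (e : α) (a : ℝ) : (fAlpha e a).subsetSum {e} = 1 + a := by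
  rw [subsetSum_singleton]
  simp [fAlpha]

theorem subsetSum_fABG_left (a b : α) (p q r : ℕ) :
    (fABG a b p q r).subsetSum {a} = 2 ^ (p + r - q + 1) := by
  rw [subsetSum_singleton]
  simp [fABG]

theorem subsetSum_fABG_right {a b : α} (hab : a ≠ b) (p q r : ℕ) :
    (fABG a b p q r).subsetSum {b} = 2 ^ (r + 1) := by
  rw [subsetSum_singleton]
  simp [fABG, hab.symm]

theorem subsetSum_fABG_pair {a b : α} (hab : a ≠ b) (p q r : ℕ) :
    (fABG a b p q r).subsetSum {a, b} = 2 ^ (p + r + 1) := by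
  have h1 : ({a, b} : Finset α) ≠ {a} := fun h => by
    have : b ∈ ({a} : Finset α) := h ▸ by simp
    simp [hab.symm] at this
  have h2 : ({a, b} : Finset α) ≠ {b} := fun h => by
    have : a ∈ ({b} : Finset α) := h ▸ by simp
    simp [hab] at this
  rw [subsetSum_pair _ hab]
  simp only [fABG, Finset.singleton_ne_empty, Finset.insert_ne_empty, h1, h2, if_false, if_true,
    Finset.singleton_inj, hab.symm]
  ring

theorem IsLogSum.subsetSum_minor {k : ℕ} {f m : BinaryFunction α} {L : Finset α → ℕ}
    (hL : f.IsLogSum k L) {A : Finset α} (hA : A ⊆ f.E) (hE : m.E ⊆ f.E)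
    (hS : ∀ X ⊆ m.E, m.subsetSum X = f.subsetSum (X ∪ A) / f.subsetSum A)
    {X : Finset α} (hX : X ⊆ m.E) : m.subsetSum X * 2 ^ L A = 2 ^ L (X ∪ A) := by
  rw [hS X hX, hL.1 A hA, hL.1 _ (Finset.union_subset (hX.trans hE) hA)]
  field_simp

theorem IsLogSum.not_isomorphic_fAlpha {k : ℕ} {f m : BinaryFunction α} {L : Finset α → ℕ}
    (hL : f.IsLogSum k L) (hm : IsMinorOf m f) {e : α} {a : ℝ}
    (ha : ¬ ∃ n : ℕ, n ≤ k ∧ a = 2 ^ n - 1) : ¬ m.Isomorphic (fAlpha e a) := by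
  rintro ⟨φ, hinj, himg, hf⟩
  obtain ⟨hE, A, hA, hd, -, hS⟩ := hm.exists_deleted
  obtain ⟨x, hx, hxe⟩ : ∃ x ∈ m.E, φ x = e := by
    rw [← Finset.mem_image, himg]
    simp [fAlpha]
  have hxm : ({x} : Finset α) ⊆ m.E := by simpa using hx
  have h1 := hL.subsetSum_minor hA hE hS hxm
  rw [Isomorphic.subsetSum_eq hinj hf hxm, Finset.image_singleton, hxe, subsetSum_fAlpha,
    ← Finset.insert_eq] at h1
  have h2 := hL.2.1 A hA x (hE hx) (Finset.disjoint_left.1 hd hx)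
  refine ha ⟨L (insert x A) - L A, by lia, ?_⟩
  rw [pow_sub₀ _ (by norm_num) h2.1, ← h1]
  field_simp
  ring

theorem IsLogSum.not_isomorphic_fABG {k : ℕ} {f m : BinaryFunction α} {L : Finset α → ℕ}
    (hL : f.IsLogSum k L) (hm : IsMinorOf m f) {a b : α} (hab : a ≠ b) {p q r : ℕ}
    (hqr : q ≤ r) : ¬ m.Isomorphic (fABG a b p q r) := by
  rintro ⟨φ, hinj, himg, hf⟩
  obtain ⟨hE, A, hA, hd, -, hS⟩ := hm.exists_deleted
  obtain ⟨x, hx, rfl⟩ : ∃ x ∈ m.E, φ x = a := by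
    rw [← Finset.mem_image, himg]
    simp [fABG]
  obtain ⟨y, hy, rfl⟩ : ∃ y ∈ m.E, φ y = b := by
    rw [← Finset.mem_image, himg]
    simp [fABG]
  have hxy : x ≠ y := fun h => hab (congrArg φ h)
  have hlog : ∀ X ⊆ m.E, ∀ n : ℕ, (fABG (φ x) (φ y) p q r).subsetSum (X.image φ) = 2 ^ n →
      n + L A = L (X ∪ A) := by
    intro X hX n hn
    have h := hL.subsetSum_minor hA hE hS hX
    rw [Isomorphic.subsetSum_eq hinj hf hX, hn, ← pow_add] at h
    exact pow_right_injective₀ (by norm_num) (by norm_num) h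
  have h1 := hlog {x} (by simpa using hx) (p + r - q + 1) (by
    rw [Finset.image_singleton, subsetSum_fABG_left])
  have h2 := hlog {y} (by simpa using hy) (r + 1) (by
    rw [Finset.image_singleton, subsetSum_fABG_right hab])
  have h3 := hlog {x, y} (by simp [Finset.insert_subset_iff, hx, hy]) (p + r + 1) (by
    rw [Finset.image_insert, Finset.image_singleton, subsetSum_fABG_pair hab])
  have h4 := hL.2.2 A hA x (hE hx) y (hE hy) (Finset.disjoint_left.1 hd hx)
    (Finset.disjoint_left.1 hd hy) hxy
  rw [← Finset.insert_eq] at h1 h2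
  rw [Finset.insert_union, ← Finset.insert_eq] at h3
  lia

theorem isomorphic_fAlpha {m : BinaryFunction α} {e : α} (hE : m.E = {e}) :
    m.Isomorphic (fAlpha e (m.f {e})) := by
  refine ⟨id, Function.injective_id.injOn, by simp [hE, fAlpha], fun X hX => ?_⟩
  rw [hE, Finset.subset_singleton_iff] at hX
  rcases hX with rfl | rfl <;> simp [fAlpha, m.empty_one]

theorem isomorphic_fABG {m : BinaryFunction α} {a b : α} (hab : a ≠ b) (hE : m.E = {a, b})
    {p q r : ℕ} (ha : m.subsetSum {a} = 2 ^ (p + r - q + 1)) (hb : m.subsetSum {b} = 2 ^ (r + 1))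
    (hp : m.subsetSum {a, b} = 2 ^ (p + r + 1)) : m.Isomorphic (fABG a b p q r) := by
  have ha' := subsetSum_fABG_left a b p q r
  have hb' := subsetSum_fABG_right hab p q r
  have hp' := subsetSum_fABG_pair hab p q r
  rw [← ha, subsetSum_singleton, subsetSum_singleton] at ha'
  rw [← hb, subsetSum_singleton, subsetSum_singleton] at hb'
  rw [← hp, subsetSum_pair _ hab, subsetSum_pair _ hab] at hp'
  refine ⟨id, Function.injective_id.injOn, by simp [hE, fABG], fun X hX => ?_⟩
  have hcases : X = ∅ ∨ X = {a} ∨ X = {b} ∨ X = {a, b} := by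
    rw [hE, ← Finset.coe_subset, Finset.coe_pair, Set.subset_pair_iff_eq] at hX
    exact_mod_cast hX
  rw [Finset.image_id]
  rcases hcases with rfl | rfl | rfl | rfl
  · rw [m.empty_one, BinaryFunction.empty_one]
  all_goals linarith

/-- If all order-one minors of `f` are allowed, then deleting any set gives a minor and
all subset sums are powers of two. -/
theorem exists_delete_minor {k : ℕ} {f : BinaryFunction α}
    (h : ∀ m, IsMinorOf m f → ∀ e, m.E = {e} → ∃ n ≤ k, m.f {e} = 2 ^ n - 1)
    {A : Finset α} (hA : A ⊆ f.E) :
    (∃ l : ℕ, f.subsetSum A = 2 ^ l) ∧ ∃ m, IsMinorOf m f ∧ m.E = f.E \ A ∧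
      ∀ X ⊆ m.E, m.subsetSum X = f.subsetSum (X ∪ A) / f.subsetSum A := by
  induction A using Finset.induction_on with
  | empty => exact ⟨⟨0, by simp [subsetSum_empty]⟩, f, .refl f, by simp [subsetSum_empty]⟩
  | insert e A heA ih =>
    rw [Finset.insert_subset_iff] at hA
    obtain ⟨⟨l, hl⟩, m, hm, hE, hS⟩ := ih hA.2
    have he : e ∈ m.E := by simp [hE, hA.1, heA]
    have he' : ({e} : Finset α) ⊆ m.E := by simpa using he
    obtain ⟨m', hm', hE', hf'⟩ := hm.exists_contract he'
    obtain ⟨n, -, hn⟩ := h m' hm' e hE'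
    rw [hf'] at hn
    have hw : 1 + m.f {e} ≠ 0 := by
      rw [hn, add_sub_cancel]
      positivity
    have h1 := hS {e} he'
    have h0 : f.subsetSum A ≠ 0 := by
      rw [hl]
      positivity
    refine ⟨⟨n + l, ?_⟩, m.delete e, .delete e he hw hm, ?_, fun X hX => ?_⟩
    · rw [subsetSum_singleton, hn, ← Finset.insert_eq, eq_div_iff h0, hl] at h1
      rw [← h1]
      ring
    · rw [delete_E, hE]
      grind
    · have heX : e ∉ X := fun h => by simpa [delete_E] using hX h
      have hXE : X ⊆ m.E := hX.trans (Finset.erase_subset _ _)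
      rw [subsetSum_delete m hw heX, hS _ (Finset.insert_subset he hXE), h1,
        div_div_div_cancel_right₀ h0, ← Finset.insert_eq, Finset.insert_union,
        Finset.union_insert]

/-- A binary function all of whose minors of order one and two are allowed has a
supermodular logarithm with steps at most `k`. -/
theorem exists_isLogSum_of_minors {k : ℕ} {f : BinaryFunction α}
    (h₁ : ∀ m, IsMinorOf m f → ∀ e, m.E = {e} → ∃ n ≤ k, m.f {e} = 2 ^ n - 1)
    (h₂ : ∀ m, IsMinorOf m f → ∀ a b, a ≠ b → ∀ p q r : ℕ, p ≤ q → q ≤ r → r + 1 ≤ k →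
      ¬ m.Isomorphic (fABG a b p q r)) : ∃ L, f.IsLogSum k L := by
  have hL : ∀ X, ∃ l : ℕ, X ⊆ f.E → f.subsetSum X = 2 ^ l := by
    intro X
    by_cases hX : X ⊆ f.E
    · obtain ⟨l, hl⟩ := (exists_delete_minor h₁ hX).1
      exact ⟨l, fun _ => hl⟩
    · exact ⟨0, fun h => absurd h hX⟩
  choose L hL using hL
  have hminor : ∀ A ⊆ f.E, ∀ B ⊆ f.E, Disjoint B A → ∃ m, IsMinorOf m f ∧ m.E = B ∧
      ∀ X ⊆ B, ∀ n, n + L A = L (X ∪ A) → m.subsetSum X = 2 ^ n := by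
    intro A hA B hB hBA
    obtain ⟨-, m, hm, hE, hS⟩ := exists_delete_minor h₁ hA
    have hBm : B ⊆ m.E := by
      rw [hE]
      exact Finset.subset_sdiff.2 ⟨hB, hBA⟩
    obtain ⟨m', hm', hE', hf'⟩ := hm.exists_contract hBm
    refine ⟨m', hm', hE', fun X hX n hn => ?_⟩
    have hSX := hS X (hX.trans hBm)
    rw [hL A hA, hL _ (Finset.union_subset (hX.trans hB) hA), ← hn, pow_add,
      mul_div_cancel_right₀ _ (by positivity)] at hSX
    rw [← hSX, subsetSum, subsetSum, hf']
  have hstep : ∀ X ⊆ f.E, ∀ e ∈ f.E, e ∉ X →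
      L X ≤ L (insert e X) ∧ L (insert e X) ≤ L X + k := by
    intro X hX e he heX
    obtain ⟨-, m, hm, hE, hS⟩ := exists_delete_minor h₁ hX
    have he' : ({e} : Finset α) ⊆ m.E := by simp [hE, he, heX]
    obtain ⟨m', hm', hE', hf'⟩ := hm.exists_contract he'
    obtain ⟨n, hnk, hn⟩ := h₁ m' hm' e hE'
    have hSe := hS {e} he'
    rw [subsetSum_singleton, ← hf', hn, add_sub_cancel, ← Finset.insert_eq, hL X hX,
      hL _ (Finset.insert_subset he hX), eq_div_iff (by positivity), ← pow_add] at hSe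
    have hnL : n + L X = L (insert e X) := pow_right_injective₀ (by norm_num) (by norm_num) hSe
    lia
  refine ⟨L, hL, hstep, ?_⟩
  have key : ∀ X ⊆ f.E, ∀ a ∈ f.E, ∀ b ∈ f.E, a ∉ X → b ∉ X → a ≠ b →
      L (insert a X) ≤ L (insert b X) →
      L (insert a X) + L (insert b X) ≤ L X + L (insert a (insert b X)) := by
    intro X hX a ha b hb haX hbX hab hle
    by_contra! hlt
    have hsa := hstep X hX a ha haX
    have hsb := hstep X hX b hb hbX
    have hsab := hstep (insert b X) (Finset.insert_subset hb hX) a ha (by simp [hab, haX])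
    obtain ⟨m, hm, hE, hS⟩ := hminor X hX {a, b}
      (by simp [Finset.insert_subset_iff, ha, hb]) (by simp [haX, hbX])
    refine h₂ m hm a b hab (L (insert a (insert b X)) - L (insert b X))
      (L (insert a (insert b X)) - L (insert a X)) (L (insert b X) - L X - 1)
      (by lia) (by lia) (by lia) (isomorphic_fABG hab hE ?_ ?_ ?_)
    · refine hS _ (by simp) _ ?_
      rw [← Finset.insert_eq]
      lia
    · refine hS _ (by simp) _ ?_
      rw [← Finset.insert_eq]
      lia
    · refine hS _ subset_rfl _ ?_
      rw [Finset.insert_union, ← Finset.insert_eq]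
      lia
  intro X hX a ha b hb haX hbX hab
  rcases le_total (L (insert a X)) (L (insert b X)) with hle | hle
  · exact key X hX a ha b hb haX hbX hab hle
  · have h := key X hX b hb a ha hbX haX hab.symm hle
    rw [Finset.insert_comm b a] at h
    lia

end BinaryFunction

open BinaryFunction in
/-- For `k ≥ 1`, a binary function is `k`-polymatroidal iff it has no
minor isomorphic to `f_α` with `α` not of the form `2^n − 1` (`0 ≤ n ≤ k`), nor to
`f_{α,β,γ}` for integers `0 ≤ α ≤ β ≤ γ ≤ k−1`. -/
theorem polymatroidal_iff_no_excluded_minor {α : Type} [DecidableEq α]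
    (k : ℕ) (hk : 1 ≤ k) (f : BinaryFunction α) :
    f.Polymatroidal k ↔
      ¬ ∃ m : BinaryFunction α, IsMinorOf m f ∧
          ((∃ (e : α) (a : ℝ), (¬ ∃ n : ℕ, n ≤ k ∧ a = 2 ^ n - 1) ∧
              m.Isomorphic (fAlpha e a)) ∨
           (∃ a b : α, a ≠ b ∧ ∃ p q r : ℕ, p ≤ q ∧ q ≤ r ∧ r ≤ k - 1 ∧
              m.Isomorphic (fABG a b p q r))) := by
  rw [polymatroidal_iff_exists_isLogSum]
  constructor
  · rintro ⟨L, hL⟩ ⟨m, hm, ⟨e, a, ha, hiso⟩ | ⟨a, b, hab, p, q, r, -, hqr, -, hiso⟩⟩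
    · exact hL.not_isomorphic_fAlpha hm ha hiso
    · exact hL.not_isomorphic_fABG hm hab hqr hiso
  · intro h
    refine exists_isLogSum_of_minors (fun m hm e hE => ?_)
      fun m hm a b hab p q r hpq hqr hr hiso => ?_
    · by_contra hn
      exact h ⟨m, hm, .inl ⟨e, m.f {e}, hn, isomorphic_fAlpha hE⟩⟩
    · exact h ⟨m, hm, .inr ⟨a, b, hab, p, q, r, hpq, hqr, by lia, hiso⟩⟩
end
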